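/- Let n, m be coprime integers, not both zero, and let ℓ and ℓ' be two lines in ℝ × ℝ, each with direction vector ((n : ℝ), (m : ℝ)) and each containing no knot (no point with both coordinates in {k/2 : k ∈ ℤ}). Then there exist ε ∈ ({1, -1} : Set ℝ) and u ∈ ℤ × ℤ such that the convex hull of ℓ ∪ {ε • x + ((u.1 : ℝ), (u.2 : ℝ)) : x ∈ ℓ'} contains no knot. (Hence any two geodesics of the same type (n, m) on the disphenoid are isomorphic: they cross the same edges in the same order.) -/

import Mathlib

/-- A real number is a half-integer if it equals `k/2` for some integer `k`. -/
def IsHalfInt (x : ℝ) : Prop := ∃ k : ℤ, x = k / 2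

/-- A point of `ℝ²` is a knot of the full net of the disphenoid if both of its
coordinates are half-integers. -/
def IsKnot (p : ℝ × ℝ) : Prop := IsHalfInt p.1 ∧ IsHalfInt p.2

/-- Twice the cross product with the direction `(n, m)`: a linear functional which is constant on
the lines of that direction and integral at the knots. -/
def knotLevel (n m : ℤ) (x : ℝ × ℝ) : ℝ := 2 * (m * x.1 - n * x.2)

lemma isLinearMap_knotLevel (n m : ℤ) : IsLinearMap ℝ (knotLevel n m) where
  map_add x y := by simp only [knotLevel, Prod.fst_add, Prod.snd_add]; ring
  map_smul c x := by
    simp only [knotLevel, Prod.smul_fst, Prod.smul_snd, smul_eq_mul]; ring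

lemma knotLevel_add_smul_direction (n m : ℤ) (p : ℝ × ℝ) (t : ℝ) :
    knotLevel n m (p + t • ((n : ℝ), (m : ℝ))) = knotLevel n m p := by
  simp only [knotLevel, Prod.fst_add, Prod.snd_add, Prod.smul_fst, Prod.smul_snd, smul_eq_mul]
  ring

lemma IsKnot.exists_knotLevel_eq {x : ℝ × ℝ} (hx : IsKnot x) (n m : ℤ) :
    ∃ k : ℤ, knotLevel n m x = k := by
  obtain ⟨⟨a, ha⟩, b, hb⟩ := hx
  refine ⟨m * a - n * b, ?_⟩
  rw [knotLevel, ha, hb]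
  push_cast
  ring

/-- A line of coprime integer direction at an integral level contains a knot. -/
lemma exists_isKnot_of_knotLevel_eq {n m : ℤ} (hco : IsCoprime n m) {p : ℝ × ℝ} {k : ℤ}
    (hk : knotLevel n m p = k) : ∃ t : ℝ, IsKnot (p + t • ((n : ℝ), (m : ℝ))) := by
  obtain ⟨a, b, hab⟩ := hco
  have hab' : (a : ℝ) * n + b * m = 1 := by exact_mod_cast hab
  rw [knotLevel] at hk
  refine ⟨a * (k * b / 2 - p.1) + b * (-(k * a) / 2 - p.2), ⟨k * b, ?_⟩, ⟨-(k * a), ?_⟩⟩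
  · simp only [Prod.fst_add, Prod.smul_fst, smul_eq_mul]
    push_cast
    linear_combination -p.1 * hab' + b / 2 * hk
  · simp only [Prod.snd_add, Prod.smul_snd, smul_eq_mul]
    push_cast
    linear_combination -p.2 * hab' - a / 2 * hk

/-- Modulo sign changes and even translations, a non-integer real number can be moved into any
open interval between consecutive integers. -/
lemma exists_sign_add_two_mul_mem_Ioo {c : ℝ} (hc : ∀ k : ℤ, c ≠ k) (k : ℤ) :
    ∃ ε ∈ ({1, -1} : Set ℝ), ∃ j : ℤ, ε * c + 2 * j ∈ Set.Ioo (k : ℝ) (k + 1) := by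
  have h₁ : (⌊c⌋ : ℝ) < c := lt_of_le_of_ne (Int.floor_le c) (hc _).symm
  have h₂ : c < ⌊c⌋ + 1 := Int.lt_floor_add_one c
  rcases Int.even_or_odd' (k - ⌊c⌋) with ⟨j, hj | hj⟩
  · refine ⟨1, by simp, j, ?_⟩
    have hj' : (k : ℝ) - ⌊c⌋ = 2 * j := by exact_mod_cast hj
    constructor <;> linarith
  · refine ⟨-1, by simp, j + 1 + ⌊c⌋, ?_⟩
    have hj' : (k : ℝ) - ⌊c⌋ = 2 * j + 1 := by exact_mod_cast hj
    push_cast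
    constructor <;> linarith

/-- Given two knot-free lines in `ℝ²` with the same coprime integer direction
`(n, m)`, some symmetry `x ↦ ε x + u` (`ε = ±1`, `u ∈ ℤ²`) of the net takes the
second line so that the convex hull of the union (the strip between the lines)
is knot-free; hence any two geodesics of type `(n, m)` on the disphenoid are
isomorphic. -/
theorem parallel_geodesics_isomorphic
    (n m : ℤ) (hco : IsCoprime n m) (hnz : ¬ (n = 0 ∧ m = 0))
    (p p' : ℝ × ℝ) (ℓ ℓ' : Set (ℝ × ℝ))
    (hℓ : ℓ = {x | ∃ t : ℝ, x = p + t • ((n : ℝ), (m : ℝ))})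
    (hℓ' : ℓ' = {x | ∃ t : ℝ, x = p' + t • ((n : ℝ), (m : ℝ))})
    (hkℓ : ∀ x ∈ ℓ, ¬ IsKnot x) (hkℓ' : ∀ x ∈ ℓ', ¬ IsKnot x) :
    ∃ ε ∈ ({1, -1} : Set ℝ), ∃ u : ℤ × ℤ,
      ∀ x ∈ convexHull ℝ (ℓ ∪ ((fun y => ε • y + ((u.1 : ℝ), (u.2 : ℝ))) '' ℓ')),
        ¬ IsKnot x := by
  have level_ne {q : ℝ × ℝ} (hq : ∀ t : ℝ, ¬ IsKnot (q + t • ((n : ℝ), (m : ℝ)))) (k : ℤ) :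
      knotLevel n m q ≠ k := fun h =>
    let ⟨t, ht⟩ := exists_isKnot_of_knotLevel_eq hco h
    hq t ht
  subst hℓ hℓ'
  have hp := level_ne fun t => hkℓ _ ⟨t, rfl⟩
  have hp' := level_ne fun t => hkℓ' _ ⟨t, rfl⟩
  set k := ⌊knotLevel n m p⌋
  obtain ⟨ε, hε, j, hj⟩ := exists_sign_add_two_mul_mem_Ioo hp' k
  obtain ⟨a, b, hab⟩ := hco
  have hab' : (a : ℝ) * n + b * m = 1 := by exact_mod_cast hab
  refine ⟨ε, hε, (j * b, -(j * a)), fun x hx hknot => ?_⟩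
  have hstrip : x ∈ knotLevel n m ⁻¹' Set.Ioo (k : ℝ) (k + 1) := by
    refine convexHull_min ?_
      ((convex_Ioo _ _).is_linear_preimage (isLinearMap_knotLevel n m)) hx
    rintro _ (⟨t, rfl⟩ | ⟨_, ⟨t, rfl⟩, rfl⟩)
    · rw [Set.mem_preimage, knotLevel_add_smul_direction]
      exact ⟨lt_of_le_of_ne (Int.floor_le _) (hp _).symm, Int.lt_floor_add_one _⟩
    · have hlin := isLinearMap_knotLevel n m
      have hu : knotLevel n m (((j * b : ℤ) : ℝ), ((-(j * a) : ℤ) : ℝ)) = 2 * j := by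
        simp only [knotLevel]
        push_cast
        linear_combination 2 * j * hab'
      simpa only [Set.mem_preimage, hlin.map_add (ε • _), hlin.map_smul ε, hu,
        knotLevel_add_smul_direction, smul_eq_mul] using hj
  obtain ⟨i, hi⟩ := hknot.exists_knotLevel_eq n m
  rw [Set.mem_preimage, hi] at hstrip
  have h₁ : k < i := by exact_mod_cast hstrip.1
  have h₂ : i < k + 1 := by exact_mod_cast hstrip.2
  omega
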